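/- (Remark 2) Let D > 0 and define the linear solution map T^D(t)φ(x) = e^{−Dt} Σ_{k=0}^∞ ((Dt)^k/k!) a_k(φ)(x) associated with u_t = D(J∗u − u). Assume f(x,0) = 0 for all x, f(x+L,u) = f(x,u) for some L > 0, β is a positive continuous L-periodic function with D((J∗β)(x) − β(x)) + f(x,β(x)) = 0 for all x, and |f(x,u₁) − f(x,u₂)| ≤ k_f |u₁ − u₂| for all x ∈ [0,L] and u₁,u₂ ∈ [0,β(x)], where k_f > 0. Let Q : [0,∞) × C_β → C_β satisfy, for each φ ∈ C_β, continuity of s ↦ Q(s)φ in the supremum norm and the variation-of-constants formula Q(t)φ = T^D(t)φ + ∫_0^t T^D(t−s) f̂(Q(s)φ) ds for all t > 0, where f̂(ψ)(x) = f(x,ψ(x)). Then for any nonempty bounded interval I = [a,b'] ⊂ ℝ, any t ≥ 0, and any B ⊆ C_β, one has α((Q(t)B)_I) ≤ e^{(k_f − D)t} α(B_I); in particular, if D > k_f then each Q(t) with t > 0 is an α-contraction relative to I. -/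

import Mathlib

open MeasureTheory Real Set
open scoped ENNReal

/-- Iterated convolutions: `a_0(φ) = φ`, `a_k(φ)(x) = ∫ J(x−y) a_{k−1}(φ)(y) dy`. -/
noncomputable def ak (J : ℝ → ℝ) : ℕ → (ℝ → ℝ) → ℝ → ℝ
  | 0, φ => φ
  | k + 1, φ => fun x => ∫ y, J (x - y) * ak J k φ y

/-- The linear solution map of `u_t = D(J∗u − u)`:
`T^D(t)φ(x) = e^{−Dt} Σ_{k=0}^∞ ((Dt)^k/k!) a_k(φ)(x)`. -/
noncomputable def TmapD (J : ℝ → ℝ) (D t : ℝ) (φ : ℝ → ℝ) (x : ℝ) : ℝ :=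
  Real.exp (-(D * t)) * ∑' k : ℕ, (D * t) ^ k / (Nat.factorial k) * ak J k φ x

/-- The Kuratowski measure of noncompactness: the infimum (in `ℝ≥0∞`, so `∞` if no
such cover exists) of all `ε` such that `A` admits a finite cover by sets of
diameter at most `ε`. -/
noncomputable def kurat {X : Type*} [PseudoEMetricSpace X] (A : Set X) : ℝ≥0∞ :=
  sInf {ε : ℝ≥0∞ | ∃ (n : ℕ) (C : Fin n → Set X), A ⊆ ⋃ i, C i ∧
    ∀ i, EMetric.diam (C i) ≤ ε}

/-- The restrictions to `[a,b']` of the members of a set `V` of functions on `ℝ`,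
regarded as a subset of the Banach space `C([a,b'], ℝ)` with the sup norm. -/
def restrictSet (a b' : ℝ) (V : Set (ℝ → ℝ)) : Set C(Set.Icc a b', ℝ) :=
  {ψ | ∃ φ ∈ V, ∀ x : Set.Icc a b', ψ x = φ ↑x}

/-- Membership of `C_β`: continuous functions `φ : ℝ → ℝ` with `0 ≤ φ(x) ≤ β(x)`. -/
def memCbeta (β : ℝ → ℝ) (φ : ℝ → ℝ) : Prop :=
  Continuous φ ∧ ∀ x, φ x ∈ Set.Icc 0 (β x)

open Filter Topology

noncomputable def tau (J : ℝ → ℝ) (h : ℝ) : ℝ := ∫ y, |J (h + y) - J y|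

lemma tau_tendsto {J : ℝ → ℝ} (hJi : Integrable J) : Tendsto (tau J) (𝓝 0) (𝓝 0) := by
  let F : Lp ℝ 1 (volume : Measure ℝ) := hJi.toL1 J
  have hc : Continuous (fun h : ℝ => (DomAddAct.mk h) +ᵥ F) := by
    have : Continuous (DomAddAct.mk : ℝ → ℝᵈᵃᵃ) := DomAddAct.continuous_mk
    have : Fact ((1:ℝ≥0∞) ≠ ∞) := ⟨by simp⟩
    fun_prop
  have h2 : ∀ h, tau J h = ‖(DomAddAct.mk h +ᵥ F) - F‖ := by
    intro h
    rw [L1.norm_eq_integral_norm]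
    unfold tau
    have hF : F =ᵐ[volume] J := hJi.coeFn_toL1
    have hF2 : (fun y => F (h + y)) =ᵐ[volume] fun y => J (h + y) :=
      (measurePreserving_add_left volume h).quasiMeasurePreserving.ae_eq_comp hF
    refine integral_congr_ae ?_
    filter_upwards [hF, hF2, Lp.coeFn_sub (DomAddAct.mk h +ᵥ F) F,
      DomAddAct.vadd_Lp_ae_eq (DomAddAct.mk h) F] with y h1 h2 h3 h4
    rw [h3]
    simp only [Pi.sub_apply, h4, Real.norm_eq_abs]
    simp at *
    rw [h2, h1]
  have h3 : Tendsto (fun h : ℝ => ‖(DomAddAct.mk h +ᵥ F) - F‖) (𝓝 0) (𝓝 ‖(DomAddAct.mk (0:ℝ) +ᵥ F) - F‖) :=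
    ((hc.sub continuous_const).norm).tendsto 0
  have h4 : tau J = fun h : ℝ => ‖(DomAddAct.mk h +ᵥ F) - F‖ := funext h2
  rw [h4]
  have : ‖(DomAddAct.mk (0:ℝ) +ᵥ F) - F‖ = 0 := by
    rw [← h2]; simp [tau]
  rwa [this] at h3

lemma tau_eq (J : ℝ → ℝ) (x x' : ℝ) : ∫ y, |J (x - y) - J (x' - y)| = tau J (x - x') := by
  unfold tau
  rw [← integral_sub_left_eq_self (fun z => |J (x - x' + z) - J z|) volume x']
  congr 1; ext y; congr 3; ring

lemma int_sub {J : ℝ → ℝ} (hJi : Integrable J) (x : ℝ) : Integrable (fun y => J (x - y)) :=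
  hJi.comp_sub_left x

lemma conv_diff {J : ℝ → ℝ} (hJi : Integrable J) (hJ1 : ∫ y, |J y| = 1) {M ε : ℝ}
    {g g' : ℝ → ℝ} (hg : ∀ y, |g y| ≤ M) (hg' : ∀ y, |g' y| ≤ M) (hgg : ∀ y, |g y - g' y| ≤ ε)
    (x x' : ℝ) (h1 : AEStronglyMeasurable (fun y => J (x - y) * g y))
    (h2 : AEStronglyMeasurable (fun y => J (x' - y) * g' y)) :
    |(∫ y, J (x - y) * g y) - ∫ y, J (x' - y) * g' y| ≤ M * tau J (x - x') + ε := by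
  have key : ∀ (z : ℝ) (k : ℝ → ℝ), (∀ y, |k y| ≤ M) → AEStronglyMeasurable (fun y => J (z - y) * k y)
      → Integrable (fun y => J (z - y) * k y) := by
    intro z k hk hm
    refine ((int_sub hJi z).norm.const_mul M).mono' hm (Eventually.of_forall fun y => ?_)
    rw [norm_mul, mul_comm]
    exact mul_le_mul_of_nonneg_right (hk y) (norm_nonneg _)
  rw [← integral_sub (key x g hg h1) (key x' g' hg' h2)]
  have hb : Integrable (fun y => M * |J (x - y) - J (x' - y)| + ε * |J (x' - y)|) :=
    (((int_sub hJi x).sub (int_sub hJi x')).abs.const_mul M).add ((int_sub hJi x').abs.const_mul ε)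
  rw [← Real.norm_eq_abs]
  refine (norm_integral_le_of_norm_le hb (Eventually.of_forall fun y => ?_)).trans_eq ?_
  · have : J (x - y) * g y - J (x' - y) * g' y = (J (x - y) - J (x' - y)) * g y + J (x' - y) * (g y - g' y) := by ring
    rw [this, Real.norm_eq_abs]
    refine (abs_add_le _ _).trans ?_
    rw [abs_mul, abs_mul, mul_comm M, mul_comm ε]
    gcongr
    · exact hg y
    · exact hgg y
  · rw [integral_add, integral_const_mul, integral_const_mul, tau_eq,
      integral_sub_left_eq_self (fun z => |J z|) volume x', hJ1, mul_one]
    · exact ((int_sub hJi x).sub (int_sub hJi x')).abs.const_mul M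
    · exact (int_sub hJi x').abs.const_mul ε

lemma conv_bound {J : ℝ → ℝ} (hJi : Integrable J) (hJ1 : ∫ y, |J y| = 1) {M : ℝ}
    {g : ℝ → ℝ} (hg : ∀ y, |g y| ≤ M) (x : ℝ) : |∫ y, J (x - y) * g y| ≤ M := by
  rw [← Real.norm_eq_abs]
  refine (norm_integral_le_of_norm_le ((int_sub hJi x).abs.const_mul M) (Eventually.of_forall fun y => ?_)).trans_eq ?_
  · rw [norm_mul, mul_comm, Real.norm_eq_abs, Real.norm_eq_abs]
    exact mul_le_mul_of_nonneg_right (hg y) (abs_nonneg _)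
  · rw [integral_const_mul, integral_sub_left_eq_self (fun z => |J z|) volume x, hJ1, mul_one]

lemma tau_nonneg (J : ℝ → ℝ) (h : ℝ) : 0 ≤ tau J h := integral_nonneg fun _ => abs_nonneg _

lemma conv_meas {J : ℝ → ℝ} (hJi : Integrable J) (hJ1 : ∫ y, |J y| = 1) {M : ℝ}
    {g : ℝ → ℝ → ℝ} (hg : ∀ s y, |g s y| ≤ M)
    (hc : ∀ s₀, ∀ ε > 0, ∀ᶠ s in 𝓝 s₀, ∀ y, |g s y - g s₀ y| ≤ ε) :
    Measurable (fun p : ℝ × ℝ => ∫ y, J (p.2 - y) * g p.1 y) := by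
  classical
  set C : Set (ℝ × ℝ) := {p | AEStronglyMeasurable (fun y => J (p.2 - y) * g p.1 y)} with hC
  have hM : 0 ≤ M := (abs_nonneg _).trans (hg 0 0)
  have hclosed : IsClosed C := by
    refine IsSeqClosed.isClosed ?_
    intro p q hp hpq
    have hp1 : Tendsto (fun n => (p n).1) atTop (𝓝 q.1) := (continuous_fst.tendsto q).comp hpq
    have hp2 : Tendsto (fun n => (p n).2) atTop (𝓝 q.2) := (continuous_snd.tendsto q).comp hpq
    have hm : TendstoInMeasure volume (fun n y => J ((p n).2 - y)) atTop (fun y => J (q.2 - y)) := by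
      refine tendstoInMeasure_of_tendsto_eLpNorm (p := 1) one_ne_zero
        (fun n => (int_sub hJi _).1) (int_sub hJi _).1 ?_
      have : ∀ n, eLpNorm ((fun y => J ((p n).2 - y)) - (fun y => J (q.2 - y))) 1 volume
          = ENNReal.ofReal (tau J ((p n).2 - q.2)) := by
        intro n
        rw [eLpNorm_one_eq_lintegral_enorm, ← tau_eq,
          ofReal_integral_eq_lintegral_ofReal
            (f := fun y => |J ((p n).2 - y) - J (q.2 - y)|) ((int_sub hJi _).sub (int_sub hJi _)).abs
            (Eventually.of_forall fun _ => abs_nonneg _)]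
        congr 1; ext y
        simp [← ofReal_norm_eq_enorm]
      simp_rw [this]
      rw [← ENNReal.ofReal_zero]
      refine ENNReal.tendsto_ofReal ((tau_tendsto hJi).comp ?_)
      rw [← sub_self q.2]
      exact hp2.sub_const _
    obtain ⟨ns, hns, hae⟩ := hm.exists_seq_tendsto_ae
    refine aestronglyMeasurable_of_tendsto_ae (u := atTop) (f := fun n y => J ((p (ns n)).2 - y) * g (p (ns n)).1 y)
      (fun n => hp (ns n)) ?_
    filter_upwards [hae] with y hy
    refine hy.mul ?_
    rw [Metric.tendsto_nhds]
    intro ε hε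
    have h1 : Tendsto (fun n => (p (ns n)).1) atTop (𝓝 q.1) := hp1.comp hns.tendsto_atTop
    filter_upwards [h1.eventually (hc q.1 (ε/2) (by positivity))] with n hn
    rw [Real.dist_eq]
    exact (hn y).trans_lt (by linarith)
  have hcont : ContinuousOn (fun p : ℝ × ℝ => ∫ y, J (p.2 - y) * g p.1 y) C := by
    intro q hq
    rw [ContinuousWithinAt, Metric.tendsto_nhds]
    intro ε hε
    have h1 : Tendsto (fun p : ℝ × ℝ => M * tau J (p.2 - q.2)) (𝓝 q) (𝓝 0) := by
      rw [← mul_zero M]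
      refine Tendsto.const_mul M ((tau_tendsto hJi).comp ?_)
      rw [← sub_self q.2]
      exact (continuous_snd.tendsto q).sub_const _
    have h2 := (continuous_fst.tendsto q).eventually (hc q.1 (ε/2) (by positivity))
    have h3 := h1.eventually (gt_mem_nhds (show (0:ℝ) < ε/2 by positivity))
    filter_upwards [mem_nhdsWithin_of_mem_nhds h2, mem_nhdsWithin_of_mem_nhds h3, self_mem_nhdsWithin] with p hp2 hp3 hpC
    rw [Real.dist_eq]
    have := conv_diff hJi hJ1 (hg p.1) (hg q.1) hp2 p.2 q.2 hpC hq
    linarith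
  have := hcont.measurable_piecewise (g := fun _ => 0) continuousOn_const hclosed.measurableSet
  convert this using 1
  ext p
  by_cases hp : p ∈ C
  · simp [hp]
  · rw [Set.piecewise_eq_of_notMem _ _ _ hp]
    exact integral_undef fun h => hp h.1

lemma ak_congr {J J' : ℝ → ℝ} (h : J =ᵐ[volume] J') (k : ℕ) (g : ℝ → ℝ) : ak J k g = ak J' k g := by
  induction k with
  | zero => rfl
  | succ k ih =>
    ext x
    simp only [ak]
    refine integral_congr_ae ?_
    have h2 : (fun y => J (x - y)) =ᵐ[volume] fun y => J' (x - y) :=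
      (Measure.measurePreserving_sub_left volume x).quasiMeasurePreserving.ae_eq_comp h
    filter_upwards [h2] with y hy
    rw [hy, ih]

lemma ak_bound {J : ℝ → ℝ} (hJi : Integrable J) (hJ1 : ∫ y, |J y| = 1) {M : ℝ}
    {g : ℝ → ℝ} (hg : ∀ y, |g y| ≤ M) (k : ℕ) : ∀ x, |ak J k g x| ≤ M := by
  induction k with
  | zero => exact hg
  | succ k ih => exact fun x => conv_bound hJi hJ1 ih x

lemma ak_equi {J : ℝ → ℝ} (hJm : Measurable J) (hJi : Integrable J) (hJ1 : ∫ y, |J y| = 1) {M : ℝ}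
    {g : ℝ → ℝ} (hg : ∀ y, |g y| ≤ M) (hgm : Measurable g) (k : ℕ) :
    Measurable (ak J k g) ∧ ∀ x x', |ak J (k+1) g x - ak J (k+1) g x'| ≤ M * tau J (x - x') := by
  have hstep : ∀ j, Measurable (ak J j g) →
      ∀ x x', |ak J (j+1) g x - ak J (j+1) g x'| ≤ M * tau J (x - x') := by
    intro j hj x x'
    have hb := ak_bound hJi hJ1 hg j
    have := conv_diff hJi hJ1 (ε := 0) hb hb (by simp) x x'
      (by fun_prop) (by fun_prop)
    simpa [ak] using this
  have hm : Measurable (ak J k g) := by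
    induction k with
    | zero => exact hgm
    | succ k ih =>
      have h1 := hstep k ih
      refine Continuous.measurable ?_
      rw [continuous_iff_continuousAt]
      intro x'
      rw [ContinuousAt, tendsto_iff_dist_tendsto_zero]
      refine squeeze_zero (fun _ => dist_nonneg) (fun x => (Real.dist_eq _ _).trans_le (h1 x x')) ?_
      rw [← mul_zero M]
      refine Tendsto.const_mul M ((tau_tendsto hJi).comp ?_)
      have : Tendsto (fun x => x - x') (𝓝 x') (𝓝 (x' - x')) := tendsto_id.sub_const _
      rwa [sub_self] at this
  exact ⟨hm, hstep k hm⟩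

lemma ak_joint {J : ℝ → ℝ} (hJm : Measurable J) (hJi : Integrable J) (hJ1 : ∫ y, |J y| = 1) {M : ℝ}
    {g : ℝ → ℝ → ℝ} (hg : ∀ s y, |g s y| ≤ M)
    (hc : ∀ s₀, ∀ ε > 0, ∀ᶠ s in 𝓝 s₀, ∀ y, |g s y - g s₀ y| ≤ ε) (k : ℕ) :
    Measurable (fun p : ℝ × ℝ => ak J (k+1) (g p.1) p.2) := by
  induction k with
  | zero => exact conv_meas hJi hJ1 hg hc
  | succ k ih =>
    have h1 : StronglyMeasurable (fun q : (ℝ × ℝ) × ℝ => J (q.1.2 - q.2) * ak J (k+1) (g q.1.1) q.2) := by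
      refine Measurable.stronglyMeasurable ?_
      have h2 : Measurable (fun q : (ℝ × ℝ) × ℝ => ak J (k+1) (g q.1.1) q.2) :=
        ih.comp (f := fun q : (ℝ × ℝ) × ℝ => (q.1.1, q.2)) (by fun_prop)
      exact (hJm.comp (by fun_prop)).mul h2
    exact (h1.integral_prod_right').measurable

noncomputable def Sg (J : ℝ → ℝ) (r : ℝ) (g : ℝ → ℝ) (x : ℝ) : ℝ :=
  ∑' k : ℕ, r ^ (k+1) / (Nat.factorial (k+1)) * ak J (k+1) g x

lemma exp_hasSum (r : ℝ) : HasSum (fun k : ℕ => r ^ k / (Nat.factorial k)) (Real.exp r) := by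
  rw [Real.exp_eq_exp_ℝ]
  exact NormedSpace.expSeries_div_hasSum_exp r

lemma exp_hasSum' (r : ℝ) : HasSum (fun k : ℕ => r ^ (k+1) / (Nat.factorial (k+1))) (Real.exp r - 1) := by
  have := (hasSum_nat_add_iff' 1).2 (exp_hasSum r)
  simpa using this

lemma Sg_term {r M : ℝ} {c : ℕ → ℝ} (hc : ∀ k, |c k| ≤ M) (k : ℕ) :
    ‖r ^ k / (Nat.factorial k) * c k‖ ≤ M * (|r| ^ k / (Nat.factorial k)) := by
  rw [norm_mul, norm_div, norm_pow, Real.norm_eq_abs, Real.norm_eq_abs, Real.norm_eq_abs, mul_comm,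
    abs_of_nonneg (a := (Nat.factorial k : ℝ)) (by positivity)]
  exact mul_le_mul_of_nonneg_right (hc k) (by positivity)

lemma Sg_summable {r M : ℝ} {c : ℕ → ℝ} (hc : ∀ k, |c k| ≤ M) :
    Summable (fun k : ℕ => r ^ k / (Nat.factorial k) * c k) :=
  Summable.of_norm_bounded ((exp_hasSum |r|).summable.mul_left M) (Sg_term hc)

lemma Sg_summable' {r M : ℝ} {c : ℕ → ℝ} (hc : ∀ k, |c k| ≤ M) :
    Summable (fun k : ℕ => r ^ (k+1) / (Nat.factorial (k+1)) * c (k+1)) :=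
  (summable_nat_add_iff (f := fun k : ℕ => r ^ k / (Nat.factorial k) * c k) 1).2 (Sg_summable hc)

section
variable {J : ℝ → ℝ} (hJm : Measurable J) (hJi : Integrable J) (hJ1 : ∫ y, |J y| = 1) {M : ℝ}

lemma TmapD_eq (hJi : Integrable J) (hJ1 : ∫ y, |J y| = 1) {g : ℝ → ℝ} (hg : ∀ y, |g y| ≤ M) (D t x : ℝ) :
    TmapD J D t g x = Real.exp (-(D * t)) * (g x + Sg J (D * t) g x) := by
  unfold TmapD Sg
  congr 1
  have := (Sg_summable (r := D * t) (fun k => ak_bound hJi hJ1 hg k x)).tsum_eq_zero_add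
  rw [this]
  simp [ak]

lemma Sg_bound (hJi : Integrable J) (hJ1 : ∫ y, |J y| = 1) {g : ℝ → ℝ} (hg : ∀ y, |g y| ≤ M) {r : ℝ} (hr : 0 ≤ r) (x : ℝ) :
    |Sg J r g x| ≤ M * (Real.exp r - 1) := by
  rw [← Real.norm_eq_abs]
  refine tsum_of_norm_bounded ((exp_hasSum' r).mul_left M) fun k => ?_
  have := Sg_term (r := r) (fun k => ak_bound hJi hJ1 hg k x) (k+1)
  rwa [abs_of_nonneg hr] at this

lemma Sg_time (hJi : Integrable J) (hJ1 : ∫ y, |J y| = 1) {g : ℝ → ℝ} (hg : ∀ y, |g y| ≤ M) {r r' : ℝ} (hr' : 0 ≤ r') (hr : r' ≤ r) (x : ℝ) :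
    |Sg J r g x - Sg J r' g x| ≤ M * (Real.exp r - Real.exp r') := by
  rw [← Real.norm_eq_abs]
  unfold Sg
  rw [← (Sg_summable' (fun k => ak_bound hJi hJ1 hg k x)).tsum_sub (Sg_summable' (fun k => ak_bound hJi hJ1 hg k x))]
  have h := ((exp_hasSum' r).sub (exp_hasSum' r')).mul_left M
  rw [show Real.exp r - 1 - (Real.exp r' - 1) = Real.exp r - Real.exp r' by ring] at h
  refine tsum_of_norm_bounded h fun k => ?_
  rw [← sub_mul, norm_mul, mul_comm, Real.norm_eq_abs, Real.norm_eq_abs]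
  have : 0 ≤ r ^ (k+1) / (Nat.factorial (k+1)) - r' ^ (k+1) / (Nat.factorial (k+1)) := by
    rw [sub_nonneg]; gcongr
  rw [abs_of_nonneg this]
  exact mul_le_mul_of_nonneg_right (ak_bound hJi hJ1 hg _ x) this

lemma Sg_space (hJm : Measurable J) (hJi : Integrable J) (hJ1 : ∫ y, |J y| = 1) {g : ℝ → ℝ} (hg : ∀ y, |g y| ≤ M) (hgm : Measurable g)
    {r : ℝ} (hr : 0 ≤ r) (x x' : ℝ) :
    |Sg J r g x - Sg J r g x'| ≤ M * tau J (x - x') * (Real.exp r - 1) := by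
  rw [← Real.norm_eq_abs]
  unfold Sg
  rw [← (Sg_summable' (fun k => ak_bound hJi hJ1 hg k x)).tsum_sub (Sg_summable' (fun k => ak_bound hJi hJ1 hg k x'))]
  refine tsum_of_norm_bounded ((exp_hasSum' r).mul_left _) fun k => ?_
  rw [← mul_sub, norm_mul, mul_comm, Real.norm_eq_abs, Real.norm_eq_abs]
  have : 0 ≤ r ^ (k+1) / (Nat.factorial (k+1)) := by positivity
  rw [abs_of_nonneg this]
  exact mul_le_mul_of_nonneg_right ((ak_equi hJm hJi hJ1 hg hgm k).2 x x') this

lemma Sg_meas (hJm : Measurable J) (hJi : Integrable J) (hJ1 : ∫ y, |J y| = 1)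
    {g : ℝ → ℝ → ℝ} (hg : ∀ s y, |g s y| ≤ M)
    (hc : ∀ s₀, ∀ ε > 0, ∀ᶠ s in 𝓝 s₀, ∀ y, |g s y - g s₀ y| ≤ ε) (D t : ℝ) :
    Measurable (fun p : ℝ × ℝ => Sg J (D * (t - p.1)) (g p.1) p.2) := by
  refine measurable_of_tendsto_metrizable (f := fun n (p : ℝ × ℝ) => ∑ k ∈ Finset.range n,
    (D * (t - p.1)) ^ (k+1) / (Nat.factorial (k+1)) * ak J (k+1) (g p.1) p.2) (fun n => ?_) ?_
  · refine Finset.measurable_sum _ fun k _ => ?_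
    exact Measurable.mul (by fun_prop) (ak_joint hJm hJi hJ1 hg hc k)
  · rw [tendsto_pi_nhds]
    intro p
    exact (Sg_summable' (fun k => ak_bound hJi hJ1 (hg p.1) k p.2)).hasSum.tendsto_sum_nat
end

noncomputable def Wf (D : ℝ) (u G : ℝ → ℝ → ℝ) (φ : ℝ → ℝ) (t x : ℝ) : ℝ :=
  Real.exp (D * t) * u t x - φ x - ∫ s in (0:ℝ)..t, Real.exp (D * s) * G s x

structure Orb (J : ℝ → ℝ) (D M : ℝ) (u G : ℝ → ℝ → ℝ) (φ : ℝ → ℝ) : Prop where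
  hJm : Measurable J
  hJi : Integrable J
  hJ1 : ∫ y, |J y| = 1
  hD : 0 < D
  hφ : ∀ y, |φ y| ≤ M
  hφm : Measurable φ
  hum : ∀ t, Measurable (u t)
  huc : ∀ x, Continuous (fun s => u s x)
  hG : ∀ s y, |G s y| ≤ M
  hGc : ∀ s₀, ∀ ε > 0, ∀ᶠ s in 𝓝 s₀, ∀ y, |G s y - G s₀ y| ≤ ε
  hV : ∀ t, 0 < t → ∀ x, u t x = TmapD J D t φ x + ∫ s in (0:ℝ)..t, TmapD J D (t - s) (G s) x

namespace Orb
variable {J : ℝ → ℝ} {D M : ℝ} {u G : ℝ → ℝ → ℝ} {φ : ℝ → ℝ}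

lemma Gcont (h : Orb J D M u G φ) (x : ℝ) : Continuous (fun s => G s x) := by
  rw [continuous_iff_continuousAt]
  intro s₀
  rw [ContinuousAt, Metric.tendsto_nhds]
  intro ε hε
  filter_upwards [h.hGc s₀ (ε/2) (by positivity)] with s hs
  rw [Real.dist_eq]
  exact (hs x).trans_lt (by linarith)

lemma hM (h : Orb J D M u G φ) : 0 ≤ M := (abs_nonneg _).trans (h.hφ 0)

lemma term_bound (h : Orb J D M u G φ) {t s : ℝ} (hs : 0 ≤ s) (hst : s ≤ t) (x : ℝ) :
    |Real.exp (D * s) * Sg J (D * (t - s)) (G s) x| ≤ M * Real.exp (D * t) := by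
  have hr : 0 ≤ D * (t - s) := mul_nonneg h.hD.le (by linarith)
  have h1 := Sg_bound h.hJi h.hJ1 (h.hG s) hr x
  rw [abs_mul, abs_of_pos (Real.exp_pos _)]
  calc _ ≤ Real.exp (D * s) * (M * Real.exp (D * (t - s))) := by
        gcongr
        exact h1.trans (mul_le_mul_of_nonneg_left (by linarith) h.hM)
    _ = M * (Real.exp (D * s) * Real.exp (D * (t - s))) := by ring
    _ = _ := by rw [← Real.exp_add]; congr 2; ring

lemma term_int (h : Orb J D M u G φ) {t a b : ℝ} (ha : 0 ≤ a) (hab : a ≤ b) (hb : b ≤ t) (x : ℝ) :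
    IntervalIntegrable (fun s => Real.exp (D * s) * Sg J (D * (t - s)) (G s) x) volume a b := by
  rw [intervalIntegrable_iff_integrableOn_Ioc_of_le hab]
  refine Measure.integrableOn_of_bounded (M := M * Real.exp (D * t)) (by simp) ?_ ?_
  · have h1 : Measurable (fun s => Sg J (D * (t - s)) (G s) x) :=
      (Sg_meas h.hJm h.hJi h.hJ1 h.hG h.hGc D t).comp (f := fun s => (s, x)) (by fun_prop)
    exact (Measurable.mul (by fun_prop) h1).aestronglyMeasurable
  · rw [ae_restrict_iff' measurableSet_Ioc]
    refine Eventually.of_forall fun s hs => ?_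
    exact h.term_bound (by linarith [hs.1]) (hs.2.trans hb) x

lemma W_pos (h : Orb J D M u G φ) {t : ℝ} (ht : 0 < t) (x : ℝ) :
    Wf D u G φ t x = Sg J (D * t) φ x + ∫ s in (0:ℝ)..t, Real.exp (D * s) * Sg J (D * (t - s)) (G s) x := by
  unfold Wf
  rw [h.hV t ht x, TmapD_eq h.hJi h.hJ1 h.hφ, mul_add, ← mul_assoc, ← Real.exp_add,
    add_neg_cancel, Real.exp_zero, one_mul, ← intervalIntegral.integral_const_mul]
  have : ∀ s, Real.exp (D * t) * TmapD J D (t - s) (G s) x =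
      Real.exp (D * s) * G s x + Real.exp (D * s) * Sg J (D * (t - s)) (G s) x := by
    intro s
    rw [TmapD_eq h.hJi h.hJ1 (h.hG s), ← mul_assoc, ← Real.exp_add, ← mul_add]
    congr 2; ring
  simp_rw [this]
  rw [intervalIntegral.integral_add _ (h.term_int le_rfl ht.le le_rfl x)]
  · ring
  · have := h.Gcont x
    exact Continuous.intervalIntegrable (by fun_prop) _ _

lemma W_bound_pos (h : Orb J D M u G φ) {t : ℝ} (ht : 0 < t) (x : ℝ) :
    |Wf D u G φ t x| ≤ M * (Real.exp (D * t) - 1) + M * Real.exp (D * t) * t := by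
  rw [h.W_pos ht]
  refine (abs_add_le _ _).trans (add_le_add (Sg_bound h.hJi h.hJ1 h.hφ (mul_nonneg h.hD.le ht.le) x) ?_)
  have := intervalIntegral.norm_integral_le_of_norm_le_const (a := 0) (b := t)
    (C := M * Real.exp (D * t)) (f := fun s => Real.exp (D * s) * Sg J (D * (t - s)) (G s) x) (by
      intro s hs
      rw [uIoc_of_le ht.le] at hs
      exact h.term_bound hs.1.le hs.2 x)
  rwa [sub_zero, abs_of_pos ht] at this

lemma u_zero (h : Orb J D M u G φ) (x : ℝ) : u 0 x = φ x := by
  have hW : Continuous (fun t => Wf D u G φ t x) := by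
    unfold Wf
    have h1 := h.Gcont x
    have h2 := h.huc x
    have h3 : Continuous (fun s => Real.exp (D * s) * G s x) := by fun_prop
    have h4 : Continuous (fun t => ∫ s in (0:ℝ)..t, Real.exp (D * s) * G s x) :=
      intervalIntegral.continuous_primitive (fun a b => h3.intervalIntegrable a b) 0
    fun_prop
  have h0 : Tendsto (fun t => Wf D u G φ t x) (𝓝[>] 0) (𝓝 0) := by
    have hb : Tendsto (fun t => M * (Real.exp (D * t) - 1) + M * Real.exp (D * t) * t) (𝓝[>] 0) (𝓝 0) := by
      have : Continuous (fun t => M * (Real.exp (D * t) - 1) + M * Real.exp (D * t) * t) := by fun_prop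
      have := (this.tendsto 0).mono_left (nhdsWithin_le_nhds (s := Ioi 0))
      simpa using this
    refine squeeze_zero_norm' ?_ hb
    filter_upwards [self_mem_nhdsWithin] with t ht
    exact h.W_bound_pos ht x
  have h1 : Tendsto (fun t => Wf D u G φ t x) (𝓝[>] 0) (𝓝 (Wf D u G φ 0 x)) :=
    (hW.tendsto 0).mono_left nhdsWithin_le_nhds
  have h2 := tendsto_nhds_unique h0 h1
  simp [Wf] at h2
  linarith

lemma Sg_zero (h : Orb J D M u G φ) (x : ℝ) : Sg J 0 φ x = 0 := by
  have := Sg_bound h.hJi h.hJ1 h.hφ le_rfl x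
  simpa using this

lemma W_eq (h : Orb J D M u G φ) {t : ℝ} (ht : 0 ≤ t) (x : ℝ) :
    Wf D u G φ t x = Sg J (D * t) φ x + ∫ s in (0:ℝ)..t, Real.exp (D * s) * Sg J (D * (t - s)) (G s) x := by
  rcases ht.eq_or_lt with rfl | ht
  · simp [Wf, h.u_zero, h.Sg_zero]
  · exact h.W_pos ht x

lemma W_bound (h : Orb J D M u G φ) {t : ℝ} (ht : 0 ≤ t) (x : ℝ) :
    |Wf D u G φ t x| ≤ M * (Real.exp (D * t) - 1) + M * Real.exp (D * t) * t := by
  rcases ht.eq_or_lt with rfl | ht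
  · simp [Wf, h.u_zero]
  · exact h.W_bound_pos ht x

lemma Sg_self_meas (h : Orb J D M u G φ) (r : ℝ) : Measurable (Sg J r φ) := by
  have := (Sg_meas h.hJm h.hJi h.hJ1 (g := fun _ => φ) (fun _ => h.hφ) (fun s ε hε => by
    simp [hε.le]) r 1).comp (f := fun x => ((0:ℝ), x)) (by fun_prop)
  simpa [Function.comp_def] using this

lemma H_meas (h : Orb J D M u G φ) {t : ℝ} (ht : 0 ≤ t) :
    Measurable (fun x => ∫ s in (0:ℝ)..t, Real.exp (D * s) * G s x) := by
  have h1 : ∀ x, ∫ s in (0:ℝ)..t, Real.exp (D * s) * G s x =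
      Real.exp (D * t) * u t x - φ x - (Sg J (D * t) φ x +
        ∫ s in Ioc (0:ℝ) t, Real.exp (D * s) * Sg J (D * (t - s)) (G s) x) := by
    intro x
    rw [← intervalIntegral.integral_of_le ht, ← h.W_eq ht]
    unfold Wf; ring
  simp_rw [h1]
  have h2 : StronglyMeasurable (fun p : ℝ × ℝ => Real.exp (D * p.2) * Sg J (D * (t - p.2)) (G p.2) p.1) := by
    refine Measurable.stronglyMeasurable (Measurable.mul (by fun_prop) ?_)
    exact (Sg_meas h.hJm h.hJi h.hJ1 h.hG h.hGc D t).comp (f := fun p : ℝ × ℝ => (p.2, p.1)) (by fun_prop)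
  have h3 := (h2.integral_prod_right' (ν := volume.restrict (Ioc 0 t))).measurable
  have h4 := h.hum t
  have h5 := h.hφm
  have h6 := h.Sg_self_meas (D * t)
  fun_prop

lemma G_meas (h : Orb J D M u G φ) {t : ℝ} (ht : 0 ≤ t) : Measurable (G t) := by
  have hn : ∀ n : ℕ, (0:ℝ) < 1 / ((n:ℝ) + 1) := fun n => by positivity
  refine measurable_of_tendsto_metrizable (f := fun (n : ℕ) x => Real.exp (-(D * t)) *
    ((1 / ((n:ℝ) + 1))⁻¹ * ((∫ s in (0:ℝ)..(t + 1 / ((n:ℝ) + 1)), Real.exp (D * s) * G s x) -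
      ∫ s in (0:ℝ)..t, Real.exp (D * s) * G s x))) (fun n => ?_) ?_
  · have h1 := h.H_meas ht
    have h2 := h.H_meas (t := t + 1 / ((n:ℝ) + 1)) (by have := hn n; linarith)
    exact ((h2.sub h1).const_mul _).const_mul _
  · rw [tendsto_pi_nhds]
    intro x
    have h1 := h.Gcont x
    have h3 : Continuous (fun s => Real.exp (D * s) * G s x) := by fun_prop
    have h4 : HasDerivAt (fun t => ∫ s in (0:ℝ)..t, Real.exp (D * s) * G s x)
      (Real.exp (D * t) * G t x) t := intervalIntegral.integral_hasDerivAt_right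
        (h3.intervalIntegrable _ _) (h3.stronglyMeasurableAtFilter _ _) h3.continuousAt
    have h5 := h4.tendsto_slope_zero
    have h6 : Tendsto (fun n : ℕ => 1 / ((n:ℝ) + 1)) atTop (𝓝[≠] 0) := by
      refine tendsto_nhdsWithin_iff.2 ⟨tendsto_one_div_add_atTop_nhds_zero_nat, ?_⟩
      exact Eventually.of_forall fun n => (hn n).ne'
    have h7 := (h5.comp h6).const_mul (Real.exp (-(D * t)))
    rw [← mul_assoc, ← Real.exp_add, neg_add_cancel, Real.exp_zero, one_mul] at h7
    exact h7

lemma W_space (h : Orb J D M u G φ) {t : ℝ} (ht : 0 ≤ t) (x x' : ℝ) :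
    |Wf D u G φ t x - Wf D u G φ t x'| ≤ M * Real.exp (D * t) * (1 + t) * tau J (x - x') := by
  rw [h.W_eq ht, h.W_eq ht, add_sub_add_comm, ← intervalIntegral.integral_sub
    (h.term_int le_rfl ht le_rfl x) (h.term_int le_rfl ht le_rfl x')]
  have hτ := tau_nonneg J (x - x')
  have hb := Sg_space h.hJm h.hJi h.hJ1 h.hφ h.hφm (mul_nonneg h.hD.le ht) x x'
  have hMτ : 0 ≤ M * tau J (x - x') := mul_nonneg h.hM hτ
  have hc := intervalIntegral.norm_integral_le_of_norm_le_const (a := 0) (b := t)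
    (C := M * tau J (x - x') * Real.exp (D * t))
    (f := fun s => Real.exp (D * s) * Sg J (D * (t - s)) (G s) x -
      Real.exp (D * s) * Sg J (D * (t - s)) (G s) x') (by
      intro s hs
      rw [uIoc_of_le ht] at hs
      have := Sg_space h.hJm h.hJi h.hJ1 (h.hG s) (h.G_meas hs.1.le)
        (mul_nonneg h.hD.le (sub_nonneg.2 hs.2)) x x'
      rw [← mul_sub, norm_mul, Real.norm_eq_abs, Real.norm_eq_abs, abs_of_pos (Real.exp_pos _)]
      calc _ ≤ Real.exp (D * s) * (M * tau J (x - x') * Real.exp (D * (t - s))) := by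
            gcongr
            exact this.trans (mul_le_mul_of_nonneg_left (by linarith) hMτ)
        _ = M * tau J (x - x') * (Real.exp (D * s) * Real.exp (D * (t - s))) := by ring
        _ = _ := by rw [← Real.exp_add]; congr 2; ring)
  rw [sub_zero, abs_of_nonneg ht, Real.norm_eq_abs] at hc
  refine (abs_add_le _ _).trans ?_
  nlinarith

lemma W_time (h : Orb J D M u G φ) {t t' : ℝ} (ht' : 0 ≤ t') (htt : t' ≤ t) (x : ℝ) :
    |Wf D u G φ t x - Wf D u G φ t' x| ≤ M * (Real.exp (D * t) - Real.exp (D * t')) * (1 + t') +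
      M * Real.exp (D * t) * (t - t') := by
  have ht := ht'.trans htt
  have hD := h.hD
  rw [h.W_eq ht, h.W_eq ht', ← intervalIntegral.integral_add_adjacent_intervals
    (h.term_int le_rfl ht' htt x) (h.term_int ht' htt le_rfl x)]
  have e : ∀ a b c d e : ℝ, a + (b + c) - (d + e) = (a - d) + (b - e) + c := by intros; ring
  rw [e, ← intervalIntegral.integral_sub
    (h.term_int le_rfl ht' htt x) (h.term_int le_rfl ht' le_rfl x)]
  have h1 := Sg_time h.hJi h.hJ1 h.hφ (mul_nonneg hD.le ht') (mul_le_mul_of_nonneg_left htt hD.le) x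
  have h2 := intervalIntegral.norm_integral_le_of_norm_le_const (a := t') (b := t)
    (C := M * Real.exp (D * t)) (f := fun s => Real.exp (D * s) * Sg J (D * (t - s)) (G s) x) (by
      intro s hs
      rw [uIoc_of_le htt] at hs
      exact h.term_bound (ht'.trans hs.1.le) hs.2 x)
  have h3 := intervalIntegral.norm_integral_le_of_norm_le_const (a := 0) (b := t')
    (C := M * (Real.exp (D * t) - Real.exp (D * t')))
    (f := fun s => Real.exp (D * s) * Sg J (D * (t - s)) (G s) x -
      Real.exp (D * s) * Sg J (D * (t' - s)) (G s) x) (by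
      intro s hs
      rw [uIoc_of_le ht'] at hs
      have := Sg_time h.hJi h.hJ1 (h.hG s) (mul_nonneg hD.le (sub_nonneg.2 hs.2))
        (mul_le_mul_of_nonneg_left (show t' - s ≤ t - s by linarith) hD.le) x
      rw [← mul_sub, norm_mul, Real.norm_eq_abs, Real.norm_eq_abs, abs_of_pos (Real.exp_pos _)]
      calc _ ≤ Real.exp (D * s) * (M * (Real.exp (D * (t - s)) - Real.exp (D * (t' - s)))) := by
            gcongr
        _ = M * (Real.exp (D * s) * Real.exp (D * (t - s)) - Real.exp (D * s) * Real.exp (D * (t' - s))) := by ring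
        _ = _ := by rw [← Real.exp_add, ← Real.exp_add]; congr 3 <;> ring)
  rw [abs_of_nonneg (sub_nonneg.2 htt), Real.norm_eq_abs] at h2
  rw [sub_zero, abs_of_nonneg ht', Real.norm_eq_abs] at h3
  refine (abs_add_le _ _).trans ?_
  refine (add_le_add (abs_add_le _ _) le_rfl).trans ?_
  nlinarith

end Orb

lemma gron {w : ℝ → ℝ} (hw : Continuous w) {A k T : ℝ} (hk : 0 < k) (hT : 0 ≤ T)
    (h : ∀ t ∈ Icc 0 T, w t ≤ A + k * ∫ s in (0:ℝ)..t, w s) : w T ≤ A * Real.exp (k * T) := by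
  have hd : ∀ t, HasDerivAt (fun t => Real.exp (-(k * t)) * (A + k * ∫ s in (0:ℝ)..t, w s))
      (Real.exp (-(k * t)) * (-k) * (A + k * ∫ s in (0:ℝ)..t, w s) + Real.exp (-(k * t)) * (k * w t)) t := by
    intro t
    have h4 : HasDerivAt (fun t => ∫ s in (0:ℝ)..t, w s) (w t) t :=
      intervalIntegral.integral_hasDerivAt_right
        (hw.intervalIntegrable _ _) (hw.stronglyMeasurableAtFilter _ _) hw.continuousAt
    have h5 : HasDerivAt (fun t => -(k * t)) (-k) t := by
      simpa using ((hasDerivAt_id' t).const_mul k).fun_neg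
    exact h5.exp.mul ((h4.const_mul k).const_add A)
  have ha : AntitoneOn (fun t => Real.exp (-(k * t)) * (A + k * ∫ s in (0:ℝ)..t, w s)) (Icc 0 T) := by
    refine antitoneOn_of_deriv_nonpos (convex_Icc 0 T)
      (fun t _ => (hd t).continuousAt.continuousWithinAt)
      (fun t _ => (hd t).differentiableAt.differentiableWithinAt) ?_
    intro t ht
    rw [(hd t).deriv]
    have := h t (interior_subset ht)
    have e := Real.exp_pos (-(k * t))
    have : Real.exp (-(k * t)) * (k * (A + k * (∫ s in (0:ℝ)..t, w s) - w t)) ≥ 0 := by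
      have : 0 ≤ A + k * (∫ s in (0:ℝ)..t, w s) - w t := by linarith
      positivity
    nlinarith
  have h1 := ha (left_mem_Icc.2 hT) (right_mem_Icc.2 hT) hT
  simp only [intervalIntegral.integral_same, mul_zero, add_zero, neg_zero, Real.exp_zero, one_mul] at h1
  have h2 := h T (right_mem_Icc.2 hT)
  have h3 : A + k * ∫ s in (0:ℝ)..T, w s = Real.exp (k * T) * (Real.exp (-(k * T)) * (A + k * ∫ s in (0:ℝ)..T, w s)) := by
    rw [← mul_assoc, ← Real.exp_add, add_neg_cancel, Real.exp_zero, one_mul]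
  rw [h3] at h2
  rw [mul_comm A]
  exact h2.trans (mul_le_mul_of_nonneg_left h1 (Real.exp_pos _).le)

lemma orb_pair {J : ℝ → ℝ} {D M : ℝ} {u G u' G' : ℝ → ℝ → ℝ} {φ φ' : ℝ → ℝ}
    (h : Orb J D M u G φ) (h' : Orb J D M u' G' φ') {kf : ℝ} (hkf : 0 < kf) {T ε η x : ℝ} (hT : 0 ≤ T)
    (hφ : |φ x - φ' x| ≤ ε)
    (hW : ∀ t ∈ Icc 0 T, |Wf D u G φ t x - Wf D u' G' φ' t x| ≤ η)
    (hG : ∀ t, |G t x - G' t x| ≤ kf * |u t x - u' t x|) :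
    |u T x - u' T x| ≤ (ε + η) * Real.exp ((kf - D) * T) := by
  have c1 := h.huc x
  have c2 := h'.huc x
  have c3 := h.Gcont x
  have c4 := h'.Gcont x
  have hw : Continuous (fun s => Real.exp (D * s) * |u s x - u' s x|) := by fun_prop
  have key := gron hw (A := ε + η) hkf hT (by
    intro t ht
    have i1 : Continuous (fun s => Real.exp (D * s) * G s x) := by fun_prop
    have i2 : Continuous (fun s => Real.exp (D * s) * G' s x) := by fun_prop
    have e : Real.exp (D * t) * (u t x - u' t x) = (φ x - φ' x) + (Wf D u G φ t x - Wf D u' G' φ' t x)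
        + ∫ s in (0:ℝ)..t, (Real.exp (D * s) * G s x - Real.exp (D * s) * G' s x) := by
      rw [intervalIntegral.integral_sub (i1.intervalIntegrable _ _) (i2.intervalIntegrable _ _)]
      unfold Wf; ring
    have e2 : Real.exp (D * t) * |u t x - u' t x| = |Real.exp (D * t) * (u t x - u' t x)| := by
      rw [abs_mul, abs_of_pos (Real.exp_pos _)]
    change Real.exp (D * t) * |u t x - u' t x| ≤ _
    rw [e2, e, ← intervalIntegral.integral_const_mul]
    refine (abs_add_le _ _).trans (add_le_add ((abs_add_le _ _).trans (add_le_add hφ (hW t ht))) ?_)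
    rw [← Real.norm_eq_abs]
    refine intervalIntegral.norm_integral_le_of_norm_le ht.1 (Eventually.of_forall fun s _ => ?_)
      (Continuous.intervalIntegrable (by fun_prop) _ _)
    rw [← mul_sub, norm_mul, Real.norm_eq_abs, Real.norm_eq_abs, abs_of_pos (Real.exp_pos _)]
    have := mul_le_mul_of_nonneg_left (hG s) (Real.exp_pos (D * s)).le
    linarith)
  have e3 : |u T x - u' T x| = Real.exp (-(D * T)) * (Real.exp (D * T) * |u T x - u' T x|) := by
    rw [← mul_assoc, ← Real.exp_add, neg_add_cancel, Real.exp_zero, one_mul]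
  rw [e3]
  refine (mul_le_mul_of_nonneg_left key (Real.exp_pos _).le).trans_eq ?_
  rw [show (kf - D) * T = -(D * T) + kf * T by ring, Real.exp_add]
  ring

lemma finPart {ι X : Type} [TopologicalSpace X] [CompactSpace X] (W : ι → X → ℝ) {C : ℝ}
    (hC : ∀ i p, |W i p| ≤ C)
    (h : ∀ q, ∀ η > 0, ∀ᶠ p in 𝓝 q, ∀ i, |W i p - W i q| ≤ η) {η : ℝ} (hη : 0 < η) :
    ∃ (K : Type) (_ : Finite K) (key : ι → K), ∀ i j, key i = key j → ∀ p, |W i p - W j p| ≤ η := by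
  obtain ⟨F, -, hF⟩ := (isCompact_univ (X := X)).elim_nhds_subcover
    (fun q => {p | ∀ i, |W i p - W i q| ≤ η / 3}) (fun q _ => h q (η/3) (by positivity))
  have hη3 : 0 < η / 3 := by positivity
  have hmem : ∀ i p, ⌊W i p / (η/3)⌋ ∈ Icc (⌊-C / (η/3)⌋) (⌊C / (η/3)⌋) := by
    intro i p
    have := abs_le.1 (hC i p)
    constructor
    · apply Int.floor_le_floor; gcongr; exact this.1
    · apply Int.floor_le_floor; gcongr; exact this.2
  refine ⟨F → Icc (⌊-C / (η/3)⌋) (⌊C / (η/3)⌋), inferInstance,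
    fun i q => ⟨⌊W i q / (η/3)⌋, hmem i q⟩, fun i j hij p => ?_⟩
  have hp := hF (mem_univ p)
  simp only [mem_iUnion] at hp
  obtain ⟨q, hq, hpq⟩ := hp
  have h1 : |W i p - W i q| ≤ η/3 := hpq i
  have h2 : |W j p - W j q| ≤ η/3 := hpq j
  have h3 := congrFun hij ⟨q, hq⟩
  simp only [Subtype.mk.injEq] at h3
  have h4 := Int.abs_sub_lt_one_of_floor_eq_floor h3
  rw [← sub_div, abs_div, abs_of_pos hη3, div_lt_one hη3] at h4
  rw [abs_le] at *
  rw [abs_lt] at h4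
  constructor <;> linarith [h1.1, h1.2, h2.1, h2.2, h4.1, h4.2]

lemma orb_part {J : ℝ → ℝ} {D M : ℝ} {ι : Type} {u G : ι → ℝ → ℝ → ℝ} {φ : ι → ℝ → ℝ}
    (h : ∀ i, Orb J D M (u i) (G i) (φ i)) {a b T η : ℝ} (hT : 0 ≤ T) (hη : 0 < η) :
    ∃ (K : Type) (_ : Finite K) (key : ι → K), ∀ i j, key i = key j → ∀ t ∈ Icc 0 T, ∀ x ∈ Icc a b,
      |Wf D (u i) (G i) (φ i) t x - Wf D (u j) (G j) (φ j) t x| ≤ η := by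
  rcases isEmpty_or_nonempty ι with hι | ⟨⟨i₀⟩⟩
  · exact ⟨PUnit, inferInstance, fun _ => PUnit.unit, fun i => hι.elim i⟩
  have hM := (h i₀).hM
  have hD := (h i₀).hD
  have hJi := (h i₀).hJi
  have hexp : ∀ t ∈ Icc 0 T, Real.exp (D * t) ≤ Real.exp (D * T) := fun t ht => by
    apply Real.exp_le_exp.2; exact mul_le_mul_of_nonneg_left ht.2 hD.le
  have htime : ∀ i, ∀ t ∈ Icc 0 T, ∀ t' ∈ Icc 0 T, ∀ x,
      |Wf D (u i) (G i) (φ i) t x - Wf D (u i) (G i) (φ i) t' x| ≤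
      M * |Real.exp (D * t) - Real.exp (D * t')| * (1 + T) + M * Real.exp (D * T) * |t - t'| := by
    intro i
    have main : ∀ t ∈ Icc 0 T, ∀ t' ∈ Icc 0 T, t' ≤ t → ∀ x,
      |Wf D (u i) (G i) (φ i) t x - Wf D (u i) (G i) (φ i) t' x| ≤
      M * |Real.exp (D * t) - Real.exp (D * t')| * (1 + T) + M * Real.exp (D * T) * |t - t'| := by
      intro t ht t' ht' htt x
      refine ((h i).W_time ht'.1 htt x).trans ?_
      have h1 : 0 ≤ Real.exp (D * t) - Real.exp (D * t') :=
        sub_nonneg.2 (Real.exp_le_exp.2 (mul_le_mul_of_nonneg_left htt hD.le))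
      rw [abs_of_nonneg h1, abs_of_nonneg (sub_nonneg.2 htt)]
      have := sub_nonneg.2 htt
      gcongr
      · exact ht'.2
      · exact ht.2
    intro t ht t' ht' x
    rcases le_total t' t with htt | htt
    · exact main t ht t' ht' htt x
    · have := main t' ht' t ht htt x
      rwa [abs_sub_comm, abs_sub_comm (Real.exp _), abs_sub_comm t'] at this
  obtain ⟨K, hK, key, hkey⟩ := finPart (ι := ι) (X := Icc (0:ℝ) T × Icc a b)
    (fun i p => Wf D (u i) (G i) (φ i) p.1 p.2)
    (C := M * Real.exp (D * T) + M * Real.exp (D * T) * T) (by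
      intro i p
      refine ((h i).W_bound p.1.2.1 p.2).trans ?_
      have h1 := hexp p.1 p.1.2
      have h2 := p.1.2.1
      have h3 := p.1.2.2
      gcongr
      linarith) (by
      intro q η hη
      let m : Icc (0:ℝ) T × Icc a b → ℝ := fun p => M * Real.exp (D * T) * (1 + T) * tau J (p.2 - q.2) +
        (M * |Real.exp (D * p.1) - Real.exp (D * q.1)| * (1 + T) + M * Real.exp (D * T) * |(p.1:ℝ) - q.1|)
      have hm : Tendsto m (𝓝 q) (𝓝 0) := by
        have h1 : Tendsto (fun p : Icc (0:ℝ) T × Icc a b => tau J (p.2 - q.2)) (𝓝 q) (𝓝 0) := by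
          refine (tau_tendsto hJi).comp ?_
          have : Continuous (fun p : Icc (0:ℝ) T × Icc a b => (p.2:ℝ) - q.2) := by fun_prop
          simpa using this.tendsto q
        have h2 : Continuous (fun p : Icc (0:ℝ) T × Icc a b => (M * |Real.exp (D * p.1) - Real.exp (D * q.1)| * (1 + T) + M * Real.exp (D * T) * |(p.1:ℝ) - q.1|)) := by fun_prop
        have h3 := (h1.const_mul (M * Real.exp (D * T) * (1 + T))).add (h2.tendsto q)
        simpa using h3
      filter_upwards [hm.eventually (gt_mem_nhds hη)] with p hp i
      have s1 := (h i).W_space p.1.2.1 p.2 q.2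
      have s2 := htime i p.1 p.1.2 q.1 q.1.2 q.2
      have s3 : M * Real.exp (D * p.1) * (1 + p.1) * tau J (p.2 - q.2) ≤
          M * Real.exp (D * T) * (1 + T) * tau J (p.2 - q.2) := by
        have h1 := hexp p.1 p.1.2
        have h2 := p.1.2.1
        have h3 := p.1.2.2
        have h4 := tau_nonneg J (p.2 - q.2)
        gcongr
      have s4 := abs_sub_le (Wf D (u i) (G i) (φ i) p.1 p.2) (Wf D (u i) (G i) (φ i) p.1 q.2)
        (Wf D (u i) (G i) (φ i) q.1 q.2)
      have s5 : m p < η := hp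
      simp only [m] at s5
      linarith) hη
  exact ⟨K, hK, key, fun i j hij t ht x hx => hkey i j hij (⟨t, ht⟩, ⟨x, hx⟩)⟩
/-- Remark 2: for the equation `u_t = D(J∗u − u) + f(x,u)` the
solution maps satisfy `α((Q(t)B)_I) ≤ e^{(k_f − D)t} α(B_I)`; in particular, if
`D > k_f` then each `Q(t)` with `t > 0` is an `α`-contraction relative to `I`. -/
theorem stmt_14 (J : ℝ → ℝ) (hJ0 : ∀ y, 0 ≤ J y) (hJi : Integrable J)
    (hJ1 : ∫ y, J y = 1) (D : ℝ) (hD : 0 < D)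
    (f : ℝ → ℝ → ℝ) (L : ℝ) (hL : 0 < L)
    (hf0 : ∀ x, f x 0 = 0) (hfper : ∀ x u, f (x + L) u = f x u)
    (β : ℝ → ℝ) (hβc : Continuous β) (hβpos : ∀ x, 0 < β x)
    (hβper : ∀ x, β (x + L) = β x)
    (hsteady : ∀ x, D * ((∫ y, J (x - y) * β y) - β x) + f x (β x) = 0)
    (kf : ℝ) (hkf : 0 < kf)
    (hlip : ∀ x ∈ Set.Icc 0 L, ∀ u₁ ∈ Set.Icc 0 (β x), ∀ u₂ ∈ Set.Icc 0 (β x),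
      |f x u₁ - f x u₂| ≤ kf * |u₁ - u₂|)
    (Q : ℝ → (ℝ → ℝ) → (ℝ → ℝ))
    (hQmap : ∀ t : ℝ, 0 ≤ t → ∀ φ, memCbeta β φ → memCbeta β (Q t φ))
    (hQcont : ∀ φ, memCbeta β φ → ∀ t : ℝ, 0 ≤ t → ∀ ε > (0 : ℝ), ∃ δ > (0 : ℝ),
      ∀ s : ℝ, 0 ≤ s → |s - t| < δ → ∀ x, |Q s φ x - Q t φ x| ≤ ε)
    (hVOC : ∀ φ, memCbeta β φ → ∀ t : ℝ, 0 < t → ∀ x,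
      Q t φ x = TmapD J D t φ x +
        ∫ s in (0 : ℝ)..t, TmapD J D (t - s) (fun y => f y (Q s φ y)) x) :
    (∀ a b' : ℝ, a ≤ b' → ∀ t : ℝ, 0 ≤ t → ∀ B : Set (ℝ → ℝ),
      (∀ φ ∈ B, memCbeta β φ) →
      kurat (restrictSet a b' ((fun φ => Q t φ) '' B)) ≤
        ENNReal.ofReal (Real.exp ((kf - D) * t)) * kurat (restrictSet a b' B)) ∧
    (D > kf → ∀ t : ℝ, 0 < t → ∀ a b' : ℝ, a ≤ b' →
      ∃ c : ℝ, 0 ≤ c ∧ c < 1 ∧ ∀ B : Set (ℝ → ℝ), (∀ φ ∈ B, memCbeta β φ) →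
        kurat (restrictSet a b' ((fun φ => Q t φ) '' B)) ≤
          ENNReal.ofReal c * kurat (restrictSet a b' B)) := by
  classical
  -- uniform Lipschitz bound
  have hlip' : ∀ x, ∀ u₁ ∈ Set.Icc 0 (β x), ∀ u₂ ∈ Set.Icc 0 (β x),
      |f x u₁ - f x u₂| ≤ kf * |u₁ - u₂| := by
    intro x
    have hper : Function.Periodic (fun x => (f x, β x)) L := fun x =>
      Prod.ext (funext fun u => hfper x u) (hβper x)
    obtain ⟨y, hy, hxy⟩ := hper.exists_mem_Ico₀ hL x
    have h1 : f x = f y := congrArg Prod.fst hxy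
    have h2 : β x = β y := congrArg Prod.snd hxy
    rw [h1, h2]
    exact hlip y ⟨hy.1, hy.2.le⟩
  obtain ⟨C, hC⟩ : ∃ C, ∀ x, β x ≤ C := by
    obtain ⟨C, hC⟩ := (isCompact_Icc (a := (0:ℝ)) (b := L)).exists_bound_of_continuousOn hβc.continuousOn
    refine ⟨C, fun x => ?_⟩
    obtain ⟨y, hy, hxy⟩ := (show Function.Periodic β L from hβper).exists_mem_Ico₀ hL x
    rw [hxy]
    exact (le_abs_self _).trans (hC y ⟨hy.1, hy.2.le⟩)
  have hC0 : 0 ≤ C := (hβpos 0).le.trans (hC 0)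
  -- measurable representative of the kernel
  have hJJ : J =ᵐ[volume] hJi.1.mk J := hJi.1.ae_eq_mk
  set J' := hJi.1.mk J with hJ'
  have hJm' : Measurable J' := hJi.1.stronglyMeasurable_mk.measurable
  have hJi' : Integrable J' := hJi.congr hJJ
  have hJ1' : ∫ y, |J' y| = 1 := by
    rw [← hJ1]
    refine integral_congr_ae ?_
    filter_upwards [hJJ] with y hy
    rw [← hy, abs_of_nonneg (hJ0 y)]
  have hT : TmapD J = TmapD J' := by
    funext D t φ x
    unfold TmapD
    simp_rw [ak_congr hJJ]
  have horb : ∀ φ : {φ : ℝ → ℝ // memCbeta β φ}, Orb J' D (C + kf * C)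
      (fun s x => Q (max s 0) φ x) (fun s x => f x (Q (max s 0) φ x)) φ := by
    rintro ⟨φ, hφ⟩
    have hQ : ∀ s : ℝ, memCbeta β (Q (max s 0) φ) := fun s => hQmap _ (le_max_right _ _) φ hφ
    have hkC : 0 ≤ kf * C := mul_nonneg hkf.le hC0
    have huni : ∀ s₀ : ℝ, ∀ ε > 0, ∀ᶠ s in 𝓝 s₀, ∀ y, |Q (max s 0) φ y - Q (max s₀ 0) φ y| ≤ ε := by
      intro s₀ ε hε
      obtain ⟨δ, hδ, hδ2⟩ := hQcont φ hφ (max s₀ 0) (le_max_right _ _) ε hε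
      have hc : Continuous (fun s : ℝ => max s 0) := by fun_prop
      have := Metric.tendsto_nhds.1 (hc.tendsto s₀) δ hδ
      filter_upwards [this] with s hs
      exact hδ2 _ (le_max_right _ _) hs
    refine ⟨hJm', hJi', hJ1', hD, ?_, hφ.1.measurable, fun t => (hQ t).1.measurable, ?_, ?_, ?_, ?_⟩
    · intro y
      have := hφ.2 y
      have h2 := hC y
      change |φ y| ≤ _
      rw [abs_of_nonneg this.1]
      linarith [this.2]
    · intro x
      rw [continuous_iff_continuousAt]
      intro s₀
      rw [ContinuousAt, Metric.tendsto_nhds]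
      intro ε hε
      filter_upwards [huni s₀ (ε/2) (by positivity)] with s hs
      rw [Real.dist_eq]
      exact (hs x).trans_lt (by linarith)
    · intro s y
      have h1 := hlip' y _ ((hQ s).2 y) 0 ⟨le_rfl, (hβpos y).le⟩
      rw [hf0, sub_zero, sub_zero, abs_of_nonneg ((hQ s).2 y).1] at h1
      have h2 := mul_le_mul_of_nonneg_left (((hQ s).2 y).2.trans (hC y)) hkf.le
      change |f y (Q (max s 0) φ y)| ≤ _
      linarith
    · intro s₀ ε hε
      filter_upwards [huni s₀ (ε / kf) (by positivity)] with s hs y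
      refine (hlip' y _ ((hQ s).2 y) _ ((hQ s₀).2 y)).trans ?_
      have := mul_le_mul_of_nonneg_left (hs y) hkf.le
      rwa [mul_div_cancel₀ _ hkf.ne'] at this
    · intro t ht x
      change Q (max t 0) φ x = _
      rw [max_eq_left ht.le, hVOC φ hφ t ht x, hT]
      congr 1
      refine intervalIntegral.integral_congr fun s hs => ?_
      rw [uIcc_of_le ht.le] at hs
      simp only [max_eq_left hs.1]
  have main : ∀ a b' : ℝ, a ≤ b' → ∀ t : ℝ, 0 ≤ t → ∀ B : Set (ℝ → ℝ),
      (∀ φ ∈ B, memCbeta β φ) →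
      kurat (restrictSet a b' ((fun φ => Q t φ) '' B)) ≤
        ENNReal.ofReal (Real.exp ((kf - D) * t)) * kurat (restrictSet a b' B) := by
    intro a b' hab t ht B hB
    set c := Real.exp ((kf - D) * t) with hc
    have hcpos : 0 < c := Real.exp_pos _
    have hc0 : ENNReal.ofReal c ≠ 0 := by simpa using hcpos
    have hct : ENNReal.ofReal c ≠ ∞ := ENNReal.ofReal_ne_top
    rw [mul_comm, ← ENNReal.div_le_iff hc0 hct]
    refine le_sInf ?_
    rintro ε ⟨n, S, hS, hdiam⟩
    rw [ENNReal.div_le_iff hc0 hct]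
    rcases eq_or_ne ε ∞ with rfl | hε
    · rw [ENNReal.top_mul hc0]; exact le_top
    refine ENNReal.le_of_forall_pos_le_add fun ρ hρ _ => ?_
    have hη : 0 < (ρ : ℝ) / c := div_pos (by exact_mod_cast hρ) hcpos
    obtain ⟨K, hK, key, hkey⟩ := orb_part horb (a := a) (b := b') ht hη
    let R : {φ : ℝ → ℝ // memCbeta β φ} → C(Set.Icc a b', ℝ) := fun φ =>
      ⟨fun x => φ.1 x, φ.2.1.comp continuous_subtype_val⟩
    let S' : Fin n × K → Set C(Set.Icc a b', ℝ) := fun p =>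
      {ψ | ∃ φ : {φ : ℝ → ℝ // memCbeta β φ}, R φ ∈ S p.1 ∧ key φ = p.2 ∧ ∀ x, ψ x = Q t φ x}
    obtain ⟨m, ⟨e⟩⟩ := Finite.exists_equiv_fin (Fin n × K)
    refine sInf_le ⟨m, fun i => S' (e.symm i), ?_, ?_⟩
    · rintro ψ ⟨_, ⟨φ, hφ, rfl⟩, hψ⟩
      have h1 : R ⟨φ, hB φ hφ⟩ ∈ restrictSet a b' B := ⟨φ, hφ, fun x => rfl⟩
      obtain ⟨i, hi⟩ := mem_iUnion.1 (hS h1)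
      refine mem_iUnion.2 ⟨e (i, key ⟨φ, hB φ hφ⟩), ?_⟩
      simp only [Equiv.symm_apply_apply]
      exact ⟨⟨φ, hB φ hφ⟩, hi, rfl, hψ⟩
    · intro i
      refine Metric.ediam_le ?_
      rintro ψ₁ ⟨φ₁, h1, k1, e1⟩ ψ₂ ⟨φ₂, h2, k2, e2⟩
      have hd : edist (R φ₁) (R φ₂) ≤ ε := (Metric.edist_le_ediam_of_mem h1 h2).trans (hdiam _)
      have hd' : dist (R φ₁) (R φ₂) ≤ ε.toReal := by
        rw [edist_dist] at hd
        exact (ENNReal.ofReal_le_iff_le_toReal hε).1 hd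
      have hb : dist ψ₁ ψ₂ ≤ (ε.toReal + ρ / c) * c := by
        refine (ContinuousMap.dist_le (by positivity)).2 fun x => ?_
        have := orb_pair (horb φ₁) (horb φ₂) hkf ht (x := x) (ε := ε.toReal) (η := ρ / c)
          ((ContinuousMap.dist_apply_le_dist x).trans hd')
          (fun s hs => hkey φ₁ φ₂ (k1.trans k2.symm) s hs x x.2)
          (fun s => hlip' x _ ((hQmap _ (le_max_right _ _) φ₁.1 φ₁.2).2 x) _
            ((hQmap _ (le_max_right _ _) φ₂.1 φ₂.2).2 x))
        rw [max_eq_left ht] at this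
        rw [Real.dist_eq, e1, e2]
        exact this
      rw [edist_dist]
      have e3 : (ε.toReal + ρ / c) * c = ε.toReal * c + ρ := by field_simp
      rw [e3] at hb
      refine (ENNReal.ofReal_le_ofReal hb).trans_eq ?_
      rw [ENNReal.ofReal_add (by positivity) (by positivity), ENNReal.ofReal_mul (by positivity),
        ENNReal.ofReal_toReal hε, ENNReal.ofReal_coe_nnreal]
  refine ⟨main, fun hDk t ht a b' hab => ⟨Real.exp ((kf - D) * t), (Real.exp_pos _).le, ?_,
    fun B hB => main a b' hab t ht.le B hB⟩⟩
  rw [Real.exp_lt_one_iff]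
  nlinarith
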